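/- Let E ⊊ K be a proper pair of algebraically closed fields, k a λ-closed subfield of K, and a ∈ K^n. Then there exist s ≥ 1, polynomials γ_1, …, γ_t ∈ k[Z_1,…,Z_s], a polynomial σ ∈ k[Z_1,…,Z_s], and polynomials r_1, …, r_l ∈ k[X_1,…,X_n, Z_1,…,Z_s] such that the set Θ = {x ∈ K^n : there exists ζ ∈ E^s with γ_u(ζ) = 0 for all u, σ(ζ) ≠ 0, and r_i(x, ζ) = 0 for all i} contains a and is contained in every tame subset of K^n over k that contains a. In particular, the point a admits a definable neighbourhood (in the pair) implying every tame condition over k satisfied by a. -/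

import Mathlib

open MvPolynomial

/-- A polynomial in the variables `X` (indexed by `Fin n`) and `Z` (indexed by `Fin r`)
is homogeneous in the variables `Z` if it is weighted homogeneous for the weight giving
`0` to each `X`-variable and `1` to each `Z`-variable. -/
def HomogeneousInZ {K : Type*} [Field K] {n r : ℕ}
    (q : MvPolynomial (Fin n ⊕ Fin r) K) : Prop :=
  ∃ d, q.IsWeightedHomogeneous (Sum.elim (fun _ => (0 : ℕ)) (fun _ => 1)) d

/-- A subset `S` of `K^n` is tame over a subfield `k` (with respect to the subfield `E`)
if it is the set of points `x` such that some nonzero tuple `ζ` from `E` satisfies a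
fixed finite system of polynomial equations `q j (x, ζ) = 0`, where each `q j` has
coefficients in `k` and is homogeneous in the variables of `ζ`. -/
def IsTameSetOver {K : Type*} [Field K] (E k : Subfield K) {n : ℕ}
    (S : Set (Fin n → K)) : Prop :=
  ∃ (r m : ℕ), 0 < r ∧ 0 < m ∧
    ∃ q : Fin m → MvPolynomial (Fin n ⊕ Fin r) K,
      (∀ j, ∀ d, coeff d (q j) ∈ k) ∧
      (∀ j, HomogeneousInZ (q j)) ∧
      S = {x | ∃ ζ : Fin r → K, (∀ i, ζ i ∈ E) ∧ ζ ≠ 0 ∧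
            ∀ j, MvPolynomial.eval (Sum.elim x ζ) (q j) = 0}

/-- The set of λ-values of a subfield `k` of `K` (with respect to the subfield `E`):
all `e ∈ E` for which there are `a₀, a₁, …, a_n ∈ k` (`n ≥ 1`) with `a₁, …, a_n`
linearly independent over `E`, and `e₁, …, e_n ∈ E` with `a₀ = e₁ a₁ + ⋯ + e_n a_n`
and `e = e₁`. -/
def lambdaSet {K : Type*} [Field K] (E k : Subfield K) : Set K :=
  {e | ∃ (n : ℕ) (a : Fin (n + 1) → K) (a₀ : K) (c : Fin (n + 1) → K),
        (∀ i, a i ∈ k) ∧ a₀ ∈ k ∧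
        (∀ b : Fin (n + 1) → K, (∀ i, b i ∈ E) → ∑ i, b i * a i = 0 → ∀ i, b i = 0) ∧
        (∀ i, c i ∈ E) ∧ a₀ = ∑ i, c i * a i ∧ e = c 0}

/-- `λ(k)`: the subfield of `E` generated by the λ-values of `k`. -/
def lambdaSubfield {K : Type*} [Field K] (E k : Subfield K) : Subfield K :=
  Subfield.closure (lambdaSet E k)

/-- A subfield `k` of `K` is λ-closed if `λ(k) ⊆ k`. -/
def LambdaClosed {K : Type*} [Field K] (E k : Subfield K) : Prop :=
  lambdaSubfield E k ≤ k

/-- A family of elements of a λ-closed field `k` which is linearly independent over `E ∩ k` is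
linearly independent over `E`. -/
lemma LambdaClosed.linearIndependent_fin {K : Type*} [Field K] {E k : Subfield K}
    (hk : LambdaClosed E k) : ∀ (m : ℕ) (v : Fin m → k),
      LinearIndependent (E.comap k.subtype) v → LinearIndependent E (fun i => (v i : K)) := by
  intro m
  induction m with
  | zero => intro v _; exact linearIndependent_empty_type
  | succ m ih =>
    intro v hv
    have hcons : (fun i => (v i : K)) = Fin.cons (v 0 : K) (fun i => (v (Fin.succ i) : K)) := by
      ext i; refine Fin.cases ?_ (fun j => ?_) i <;> simp
    have hv' : v = Fin.cons (v 0) (fun i => v (Fin.succ i)) := by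
      ext i; refine Fin.cases ?_ (fun j => ?_) i <;> simp
    rw [hv', linearIndependent_finCons] at hv
    rw [hcons, linearIndependent_finCons]
    have hind := ih _ hv.1
    refine ⟨hind, fun hmem => hv.2 ?_⟩
    obtain ⟨c, hc⟩ := (Submodule.mem_span_range_iff_exists_fun _).1 hmem
    have hck : ∀ i, (c i : K) ∈ k := by
      intro i
      obtain _ | m := m
      · exact i.elim0
      apply hk
      apply Subfield.subset_closure
      refine ⟨m, fun j => v (Fin.succ (Equiv.swap 0 i j)), v 0, fun j => c (Equiv.swap 0 i j),
        fun _ => Subtype.coe_prop _, Subtype.coe_prop _, ?_, fun _ => Subtype.coe_prop _, ?_, ?_⟩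
      · intro b hb hsum j
        have := hind.comp _ (Equiv.swap 0 i).injective
        rw [Fintype.linearIndependent_iff] at this
        have h2 := this (fun j => ⟨b j, hb j⟩) (by simpa [Subfield.smul_def] using hsum) j
        simpa using congrArg Subtype.val h2
      · rw [← hc]
        simp only [Subfield.smul_def, smul_eq_mul]
        exact (Equiv.sum_comp (Equiv.swap 0 i) (fun j => (c j : K) * (v (Fin.succ j) : K))).symm
      · simp
    refine (Submodule.mem_span_range_iff_exists_fun _).2
      ⟨fun i => ⟨⟨c i, hck i⟩, (c i).2⟩, ?_⟩
    apply Subtype.ext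
    rw [← hc]
    simp [Subfield.smul_def]

lemma LambdaClosed.linearIndependent {K : Type*} [Field K] {E k : Subfield K}
    (hk : LambdaClosed E k) {ι : Type*} {v : ι → k}
    (hv : LinearIndependent (E.comap k.subtype) v) :
    LinearIndependent E (fun i => (v i : K)) := by
  rw [linearIndependent_iff_finset_linearIndependent]
  intro s
  rw [← linearIndependent_equiv s.equivFin.symm]
  exact hk.linearIndependent_fin _ (fun i => v (s.equivFin.symm i))
    ((hv.comp _ Subtype.val_injective).comp _ s.equivFin.symm.injective)

/-- If `k` is λ-closed and every linear relation with coefficients in `E ∩ k` between the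
elements `u d` of `E` also holds between the `u' d`, then so does every relation with
coefficients in `k`. -/
lemma LambdaClosed.sum_mul_eq_zero {K : Type*} [Field K] {E k : Subfield K}
    (hk : LambdaClosed E k) {δ : Type*} (D : Finset δ) (c : δ → k) (u u' : δ → E)
    (h : ∀ t : δ → E.comap k.subtype,
      ∑ d ∈ D, ((t d : k) : K) * u d = 0 → ∑ d ∈ D, ((t d : k) : K) * u' d = 0)
    (hu : ∑ d ∈ D, (c d : K) * u d = 0) : ∑ d ∈ D, (c d : K) * u' d = 0 := by
  classical
  let b := Module.Basis.ofVectorSpace (E.comap k.subtype) k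
  have hb := hk.linearIndependent b.linearIndependent
  let T := D.biUnion fun d => (b.repr (c d)).support
  have hc : ∀ d ∈ D, (c d : K) = ∑ β ∈ T, ((b.repr (c d) β : k) : K) * (b β : K) := by
    intro d hd
    have h1 : ((b.repr (c d)).sum fun i a => a • b i) = c d := b.linearCombination_repr (c d)
    rw [Finsupp.sum_of_support_subset _
      (Finset.subset_biUnion_of_mem (fun d => (b.repr (c d)).support) hd) _ (by simp)] at h1
    have h2 := congrArg Subtype.val h1
    rw [← h2]
    simp [Subfield.smul_def, T]
  have key : ∀ w : δ → E, ∑ d ∈ D, (c d : K) * w d =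
      ∑ β ∈ T, (∑ d ∈ D, ((b.repr (c d) β : k) : K) * w d) * (b β : K) := by
    intro w
    simp only [Finset.sum_mul]
    rw [Finset.sum_comm]
    refine Finset.sum_congr rfl fun d hd => ?_
    rw [hc d hd, Finset.sum_mul]
    exact Finset.sum_congr rfl fun _ _ => by ring
  rw [key] at hu ⊢
  refine Finset.sum_eq_zero fun β hβ => ?_
  have := linearIndependent_iff'.1 hb T
    (fun β => ∑ d ∈ D, (⟨(b.repr (c d) β : k), (b.repr (c d) β).2⟩ : E) * u d)
    (by simpa [Subfield.smul_def] using hu) β hβ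
  rw [h (fun d => b.repr (c d) β) (by simpa using congrArg Subtype.val this), zero_mul]

/-- Hilbert's Nullstellensatz: a proper ideal of a polynomial ring over `F` has a zero in any
algebraically closed extension of `F`. -/
lemma exists_algHom_of_ne_top {F L σ : Type*} [Field F] [Field L] [IsAlgClosed L] [Algebra F L]
    [Finite σ] (I : Ideal (MvPolynomial σ F)) (hI : I ≠ ⊤) :
    ∃ ψ : MvPolynomial σ F →ₐ[F] L, ∀ p ∈ I, ψ p = 0 := by
  obtain ⟨M, hM, hIM⟩ := I.exists_le_maximal hI
  let _ : Field (MvPolynomial σ F ⧸ M) := Ideal.Quotient.field M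
  have : Module.Finite F (MvPolynomial σ F ⧸ M) := finite_of_finite_type_of_isJacobsonRing _ _
  let φ : (MvPolynomial σ F ⧸ M) →ₐ[F] L := IsAlgClosed.lift
  refine ⟨φ.comp (Ideal.Quotient.mkₐ F M), fun p hp => ?_⟩
  rw [AlgHom.comp_apply, Ideal.Quotient.mkₐ_eq_mk, Ideal.Quotient.eq_zero_iff_mem.2 (hIM hp),
    map_zero]

/-- Main theorem of elimination theory, in terms of specializations: if `g` is a
specialization of `f`, then any point of projective space over `L` specializes along with it. -/
lemma exists_ne_zero_specialization {B L : Type*} [CommRing B] [Field L] [IsAlgClosed L]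
    (f g : B →+* L) (hfg : RingHom.ker f ≤ RingHom.ker g) {r : ℕ} (ξ : Fin r → L) (hξ : ξ ≠ 0) :
    ∃ ξ' : Fin r → L, ξ' ≠ 0 ∧ ∀ (P : MvPolynomial (Fin r) B) (d : ℕ), P.IsHomogeneous d →
      eval₂ f ξ P = 0 → eval₂ g ξ' P = 0 := by
  have hp : (RingHom.ker g).IsPrime := RingHom.ker_isPrime g
  let R := Localization.AtPrime (RingHom.ker g)
  have hfu : ∀ y : (RingHom.ker g).primeCompl, IsUnit (f y) := fun y =>
    isUnit_iff_ne_zero.2 fun h0 => y.2 (hfg h0)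
  have hgu : ∀ y : (RingHom.ker g).primeCompl, IsUnit (g y) := fun y =>
    isUnit_iff_ne_zero.2 fun h0 => y.2 h0
  let f' : R →+* L := IsLocalization.lift hfu
  let g' : R →+* L := IsLocalization.lift hgu
  have hf' : ∀ b, f' (algebraMap B R b) = f b := IsLocalization.lift_eq hfu
  have hg' : ∀ b, g' (algebraMap B R b) = g b := IsLocalization.lift_eq hgu
  have : IsLocalHom g' := by
    refine ⟨fun x hx => ?_⟩
    obtain ⟨b, s, rfl⟩ := IsLocalization.exists_mk'_eq (RingHom.ker g).primeCompl x
    rw [IsLocalization.AtPrime.isUnit_mk'_iff R (RingHom.ker g)]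
    intro hb
    have : g' (IsLocalization.mk' R b s) * g s = g b := by
      rw [← hg', ← hg', ← map_mul, IsLocalization.mk'_spec]
    rw [RingHom.mem_ker.1 hb] at this
    exact (mul_ne_zero hx.ne_zero (hgu s).ne_zero) this
  obtain ⟨V, hV, hloc⟩ := IsLocalRing.exists_factor_valuationRing f'
  let F := IsLocalRing.ResidueField R
  let κ := IsLocalRing.ResidueField V
  let fV : R →+* V := f'.codRestrict V.toSubring hV
  have : IsLocalHom fV := hloc
  let _ : Algebra F κ := (IsLocalRing.ResidueField.map fV).toAlgebra
  let _ : Algebra F L := (IsLocalRing.ResidueField.lift g').toAlgebra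
  obtain ⟨i₁, hi₁⟩ := Function.ne_iff.1 hξ
  obtain ⟨i₀, -, hi₀⟩ := Finset.exists_max_image Finset.univ (fun i => V.valuation (ξ i))
    ⟨i₁, Finset.mem_univ _⟩
  have hne : ξ i₀ ≠ 0 := by
    intro h0
    have := hi₀ i₁ (Finset.mem_univ _)
    rw [h0, map_zero, nonpos_iff_eq_zero, map_eq_zero] at this
    exact hi₁ this
  have hmem : ∀ i, ξ i / ξ i₀ ∈ V := by
    intro i
    rw [← V.valuation_le_one_iff, map_div₀]
    exact div_le_one_of_le₀ (hi₀ i (Finset.mem_univ _)) zero_le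
  let ξV : Fin r → V := fun i => ⟨ξ i / ξ i₀, hmem i⟩
  let η : Fin r → κ := fun i => IsLocalRing.residue V (ξV i)
  let I : Ideal (MvPolynomial (Fin r) F) := RingHom.ker (aeval (R := F) η)
  have hI : I ≠ ⊤ := RingHom.ker_ne_top _
  obtain ⟨ψ, hψ⟩ := exists_algHom_of_ne_top (L := L) I hI
  refine ⟨fun i => ψ (X i), fun h0 => ?_, fun P d hP hPξ => ?_⟩
  · have h1 : ψ (X i₀ - 1) = 0 := by
      apply hψ
      have : ξV i₀ = 1 := Subtype.ext (div_self hne)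
      simp [I, RingHom.mem_ker, η, this]
    have := congrFun h0 i₀
    simp only [Pi.zero_apply] at this
    simp [this] at h1
  · let ρ : B →+* F := (IsLocalRing.residue R).comp (algebraMap B R)
    have h1 : MvPolynomial.map ρ P ∈ I := by
      rw [RingHom.mem_ker]
      change aeval η (MvPolynomial.map ρ P) = 0
      rw [aeval_def, eval₂_map]
      have e1 : (algebraMap F κ).comp ρ =
          (IsLocalRing.residue V).comp (fV.comp (algebraMap B R)) := by
        ext b; rfl
      rw [e1]
      change eval₂ _ (IsLocalRing.residue V ∘ ξV) P = 0
      rw [← eval₂_comp_left]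
      have : eval₂ (fV.comp (algebraMap B R)) ξV P = 0 := by
        apply Subtype.ext
        change V.subtype _ = _
        rw [eval₂_comp_left]
        have e2 : V.subtype.comp (fV.comp (algebraMap B R)) = f := by
          ext b; exact hf' b
        rw [e2]
        have e3 : eval₂ f (V.subtype ∘ ξV) P = (ξ i₀)⁻¹ ^ d * eval₂ f ξ P := by
          rw [eval₂_eq, eval₂_eq, Finset.mul_sum]
          refine Finset.sum_congr rfl fun m hm => ?_
          have hd : d = ∑ i ∈ m.support, m i := by
            rw [← hP (mem_support_iff.1 hm)]
            simp [Finsupp.weight_apply, Finsupp.sum]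
          rw [hd, ← Finset.prod_pow_eq_pow_sum]
          have : ∏ i ∈ m.support, (V.subtype ∘ ξV) i ^ m i =
              (∏ i ∈ m.support, (ξ i₀)⁻¹ ^ m i) * ∏ i ∈ m.support, ξ i ^ m i := by
            rw [← Finset.prod_mul_distrib]
            refine Finset.prod_congr rfl fun i _ => ?_
            change (ξ i / ξ i₀) ^ m i = _
            rw [div_eq_inv_mul, mul_pow]
          rw [this]; ring
        rw [e3, hPξ, mul_zero]; rfl
      rw [this, map_zero]
    have h2 := hψ _ h1
    have e4 : ψ (MvPolynomial.map ρ P) = eval₂ g (fun i => ψ (X i)) P := by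
      rw [show ψ = aeval (fun i => ψ (X i)) from aeval_unique ψ, aeval_def, eval₂_map]
      simp only [aeval_X]
      congr 1
      ext b
      exact hg' b
    rwa [e4] at h2

/-- Over a λ-closed field `k`, a specialization `ζ` of a tuple `e` from `E` can be extended to
any point of projective space over `E`. -/
lemma LambdaClosed.exists_specialization {K : Type*} [Field K] {E k : Subfield K} [IsAlgClosed E]
    (hk : LambdaClosed E k) {s r : ℕ} (e ζ : Fin s → E)
    (h : ∀ p : MvPolynomial (Fin s) k,
      eval₂ k.subtype (fun i => (e i : K)) p = 0 → eval₂ k.subtype (fun i => (ζ i : K)) p = 0)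
    (ξ : Fin r → E) (hξ : ξ ≠ 0) :
    ∃ ξ' : Fin r → E, ξ' ≠ 0 ∧ ∀ (P : MvPolynomial (Fin r) (MvPolynomial (Fin s) k)) (d : ℕ),
      P.IsHomogeneous d →
      eval₂ (eval₂Hom k.subtype fun i => (e i : K)) (fun i => (ξ i : K)) P = 0 →
      eval₂ (eval₂Hom k.subtype fun i => (ζ i : K)) (fun i => (ξ' i : K)) P = 0 := by
  let j : E.comap k.subtype →+* E :=
    (k.subtype.comp (E.comap k.subtype).subtype).codRestrict E fun x => x.2
  have hj : ∀ (x : Fin s → E) (p : MvPolynomial (Fin s) (E.comap k.subtype)),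
      ((eval₂Hom j x p : E) : K) = eval₂ k.subtype (fun i => (x i : K))
        (MvPolynomial.map (E.comap k.subtype).subtype p) := by
    intro x p
    rw [eval₂_map]
    exact eval₂_comp_left E.subtype j x p
  obtain ⟨ξ', hξ', H⟩ := exists_ne_zero_specialization (eval₂Hom j e) (eval₂Hom j ζ)
    (fun p hp => by
      rw [RingHom.mem_ker] at hp ⊢
      apply Subtype.ext
      rw [hj]
      apply h
      rw [← hj, hp]
      rfl) ξ hξ
  refine ⟨ξ', hξ', fun P d hP h0 => ?_⟩
  let D := P.support.sigma fun m => (P.coeff m).support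
  let u : (Fin s → E) → (Fin r → E) → (Σ _ : Fin r →₀ ℕ, Fin s →₀ ℕ) → E := fun x y i =>
    (∏ l, x l ^ i.2 l) * ∏ l, y l ^ i.1 l
  have expand : ∀ (x : Fin s → E) (y : Fin r → E),
      eval₂ (eval₂Hom k.subtype fun i => (x i : K)) (fun i => (y i : K)) P =
        ∑ i ∈ D, (((P.coeff i.1).coeff i.2 : k) : K) * u x y i := by
    intro x y
    rw [eval₂_eq', Finset.sum_sigma]
    refine Finset.sum_congr rfl fun m _ => ?_
    rw [coe_eval₂Hom, eval₂_eq', Finset.sum_mul]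
    refine Finset.sum_congr rfl fun w _ => ?_
    simp [u, mul_assoc]
  rw [expand] at h0 ⊢
  refine hk.sum_mul_eq_zero D _ _ _ (fun t ht => ?_) h0
  let Q : MvPolynomial (Fin r) (MvPolynomial (Fin s) (E.comap k.subtype)) :=
    ∑ i ∈ D, monomial i.1 (monomial i.2 (t i))
  have hQ : Q.IsHomogeneous d := by
    refine IsHomogeneous.sum _ _ _ fun i hi => isHomogeneous_monomial _ ?_
    have := hP (mem_support_iff.1 (Finset.mem_sigma.1 hi).1)
    rw [Finsupp.degree_eq_weight_one]
    exact this
  have expandQ : ∀ (x : Fin s → E) (y : Fin r → E), ((eval₂ (eval₂Hom j x) y Q : E) : K) =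
      ∑ i ∈ D, ((t i : k) : K) * u x y i := by
    intro x y
    simp only [Q, eval₂_sum, eval₂_monomial, coe_eval₂Hom]
    rw [AddSubmonoidClass.coe_finsetSum]
    refine Finset.sum_congr rfl fun i _ => ?_
    have hji : (j (t i) : K) = ((t i : k) : K) := rfl
    simp [u, Finsupp.prod_fintype, mul_assoc, hji]
  have h1 : eval₂ (eval₂Hom j e) ξ Q = 0 := Subtype.ext (by rw [expandQ, ht]; rfl)
  rw [← expandQ, H Q d hQ h1]
  rfl

/-- Finitely many elements of the ring generated by two subfields `k` and `E` are values of
polynomials over `k` at a single tuple from `E`. -/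
lemma exists_eval₂_eq_of_mem_adjoin {K : Type*} [Field K] (E k : Subfield K) (D : Finset K)
    (hD : ∀ x ∈ D, x ∈ Algebra.adjoin k (E : Set K)) :
    ∃ (s : ℕ) (e : Fin s → E) (p : K → MvPolynomial (Fin s) k), 0 < s ∧
      ∀ x ∈ D, eval₂ k.subtype (fun i => (e i : K)) (p x) = x := by
  classical
  have h1 : ∀ x : K, ∃ p : MvPolynomial E k, x ∈ D → aeval (fun y : E => (y : K)) p = x := by
    intro x
    by_cases hx : x ∈ D
    · have := hD x hx
      rw [Algebra.adjoin_eq_range] at this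
      obtain ⟨p, hp⟩ := this
      exact ⟨p, fun _ => hp⟩
    · exact ⟨0, fun h => absurd h hx⟩
  choose p hp using h1
  let V : Finset E := insert 0 (D.biUnion fun x => (p x).vars)
  have h2 : ∀ x : K, ∃ q : MvPolynomial V k, x ∈ D → rename (fun y : V => (y : E)) q = p x := by
    intro x
    by_cases hx : x ∈ D
    · have : p x ∈ supported k (V : Set E) := by
        rw [mem_supported]
        intro y hy
        exact Finset.mem_insert_of_mem (Finset.mem_biUnion.2 ⟨x, hx, hy⟩)
      rw [supported_eq_range_rename] at this
      obtain ⟨q, hq⟩ := this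
      exact ⟨q, fun _ => hq⟩
    · exact ⟨0, fun h => absurd h hx⟩
  choose q hq using h2
  refine ⟨V.card, fun i => V.equivFin.symm i, fun x => rename V.equivFin (q x),
    Finset.card_pos.2 ⟨0, Finset.mem_insert_self _ _⟩, fun x hx => ?_⟩
  rw [eval₂_rename]
  have := hp x hx
  rw [← hq x hx, aeval_rename, aeval_def] at this
  refine Eq.trans (congrArg (fun v => eval₂ k.subtype v (q x)) (funext fun y => ?_)) this
  simp

/-- Every set of polynomials has a finite subset whose leading exponents
divide all leading exponents of the set. -/
lemma exists_finset_degree_le {σ K : Type*} [Finite σ] [Field K] (mo : MonomialOrder σ)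
    (S : Set (MvPolynomial σ K)) :
    ∃ G : Finset (MvPolynomial σ K), (∀ g ∈ G, g ∈ S ∧ g ≠ 0) ∧
      ∀ f ∈ S, f ≠ 0 → ∃ g ∈ G, mo.degree g ≤ mo.degree f := by
  classical
  let T : Set (σ →₀ ℕ) := mo.degree '' {f | f ∈ S ∧ f ≠ 0}
  have hfin : {x | Minimal (· ∈ T) x}.Finite :=
    WellQuasiOrderedLE.finite_of_isAntichain (setOfPred_minimal_antichain _)
  have hex : ∀ x : σ →₀ ℕ, ∃ f, x ∈ T → (f ∈ S ∧ f ≠ 0) ∧ mo.degree f = x := by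
    intro x
    by_cases hx : x ∈ T
    · obtain ⟨f, hf, rfl⟩ := hx
      exact ⟨f, fun _ => ⟨hf, rfl⟩⟩
    · exact ⟨0, fun h => absurd h hx⟩
  choose F hF using hex
  refine ⟨hfin.toFinset.image F, ?_, fun f hf hf0 => ?_⟩
  · simp only [Finset.mem_image, Set.Finite.mem_toFinset, forall_exists_index, and_imp]
    rintro g x hx rfl
    exact (hF x hx.1).1
  · obtain ⟨x, hxf, hx⟩ := exists_minimal_le_of_wellFoundedLT (· ∈ T) (mo.degree f)
      ⟨f, ⟨hf, hf0⟩, rfl⟩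
    refine ⟨F x, Finset.mem_image_of_mem _ (hfin.mem_toFinset.2 hx), ?_⟩
    rwa [(hF x hx.1).2]

/-- Pseudo-division of a monomial by a family of polynomials `r i` with leading exponents `μ i`
and leading coefficients dividing `c`. -/
lemma exists_pseudo_remainder {σ B ι : Type*} [CommRing B] (mo : MonomialOrder σ)
    (r : ι → MvPolynomial σ B) (μ : ι → σ →₀ ℕ)
    (hr : ∀ i, ∀ m ∈ (r i).support, mo.toSyn m ≤ mo.toSyn (μ i)) (c : B)
    (hc : ∀ i, coeff (μ i) (r i) ∣ c) (α : σ →₀ ℕ) :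
    ∃ (N : ℕ) (ρ : MvPolynomial σ B), (∀ b ∈ ρ.support, ∀ i, ¬ μ i ≤ b) ∧
      monomial α (c ^ N) - ρ ∈ Ideal.span (Set.range r) := by
  classical
  have hsupp : ∀ (x : B) (f : MvPolynomial σ B), (C x * f).support ⊆ f.support := by
    intro x f
    rw [← smul_eq_C_mul]
    exact support_smul
  let Good : MvPolynomial σ B → Prop := fun f =>
    ∃ (N : ℕ) (ρ : MvPolynomial σ B), (∀ b ∈ ρ.support, ∀ i, ¬ μ i ≤ b) ∧
      C (c ^ N) * f - ρ ∈ Ideal.span (Set.range r)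
  have hadd : ∀ f g, Good f → Good g → Good (f + g) := by
    rintro f g ⟨N, ρ, hρ, h⟩ ⟨N', ρ', hρ', h'⟩
    refine ⟨N + N', C (c ^ N') * ρ + C (c ^ N) * ρ', ?_, ?_⟩
    · intro b hb
      rcases Finset.mem_union.1 (support_add hb) with hb | hb
      · exact hρ b (hsupp _ _ hb)
      · exact hρ' b (hsupp _ _ hb)
    · have := Ideal.add_mem _ (Ideal.mul_mem_left _ (C (c ^ N')) h)
        (Ideal.mul_mem_left _ (C (c ^ N)) h')
      convert this using 1
      rw [pow_add, C_mul]; ring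
  have hmul : ∀ (x : B) f, Good f → Good (C x * f) := by
    rintro x f ⟨N, ρ, hρ, h⟩
    refine ⟨N, C x * ρ, fun b hb => hρ b (hsupp _ _ hb), ?_⟩
    convert Ideal.mul_mem_left _ (C x) h using 1
    ring
  have hsum : ∀ {τ : Type _} (D : Finset τ) (f : τ → MvPolynomial σ B),
      (∀ i ∈ D, Good (f i)) → Good (∑ i ∈ D, f i) := by
    intro τ D f hf
    refine Finset.sum_induction f Good hadd ⟨0, 0, by simp, by simp⟩ hf
  have hmain : ∀ α, Good (monomial α 1) := by
    intro α
    induction hx : mo.toSyn α using WellFoundedLT.induction generalizing α with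
    | ind x ih =>
    subst hx
    by_cases hα : ∃ i, μ i ≤ α
    · obtain ⟨i, hi⟩ := hα
      obtain ⟨β, rfl⟩ := exists_add_of_le hi
      obtain ⟨c', hc'⟩ := hc i
      have htail : Good (∑ m ∈ (r i).support.erase (μ i),
          C (coeff m (r i)) * monomial (m + β) 1) := by
        refine hsum _ _ fun m hm => hmul _ _ (ih _ ?_ _ rfl)
        rw [map_add, map_add]
        refine add_lt_add_left (lt_of_le_of_ne (hr i m (Finset.mem_of_mem_erase hm)) ?_) _
        exact fun h => Finset.ne_of_mem_erase hm (mo.toSyn.injective h)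
      have hdecomp : monomial β 1 * r i = C (coeff (μ i) (r i)) * monomial (μ i + β) 1 +
          ∑ m ∈ (r i).support.erase (μ i), C (coeff m (r i)) * monomial (m + β) 1 := by
        conv_lhs => rw [(r i).as_sum, Finset.mul_sum]
        simp only [monomial_mul, C_mul_monomial, one_mul, mul_one, add_comm β]
        by_cases hm : μ i ∈ (r i).support
        · exact (Finset.add_sum_erase _ (fun m => monomial (m + β) (coeff m (r i))) hm).symm
        · rw [Finset.erase_eq_of_notMem hm, notMem_support_iff.1 hm]; simp
      obtain ⟨N, ρ, hρ, h⟩ := hmul (-c') _ htail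
      refine ⟨N + 1, ρ, hρ, ?_⟩
      have h2 := Ideal.add_mem _ h (Ideal.mul_mem_left _ (C (c ^ N) * C c' * monomial β 1)
        (Ideal.subset_span (Set.mem_range_self i) : r i ∈ Ideal.span (Set.range r)))
      convert h2 using 1
      rw [mul_assoc _ (monomial β 1) (r i), hdecomp, pow_succ, hc', C_mul, C_mul, C_neg]
      ring
    · refine ⟨0, monomial α 1, fun b hb i hi => hα ⟨i, ?_⟩, by simp⟩
      rwa [Finset.mem_singleton.1 (support_monomial_subset hb)] at hi
  obtain ⟨N, ρ, hρ, h⟩ := hmain α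
  exact ⟨N, ρ, hρ, by rwa [C_mul_monomial, mul_one] at h⟩

/-- Pseudo-division of finitely many monomials, with a common exponent. -/
lemma exists_pseudo_remainder_finset {σ B ι δ : Type*} [CommRing B] (mo : MonomialOrder σ)
    (r : ι → MvPolynomial σ B) (μ : ι → σ →₀ ℕ)
    (hr : ∀ i, ∀ m ∈ (r i).support, mo.toSyn m ≤ mo.toSyn (μ i)) (c : B)
    (hc : ∀ i, coeff (μ i) (r i) ∣ c) (D : Finset δ) (α : δ → σ →₀ ℕ) :
    ∃ (N : ℕ) (ρ : δ → MvPolynomial σ B), ∀ d ∈ D, (∀ b ∈ (ρ d).support, ∀ i, ¬ μ i ≤ b) ∧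
      monomial (α d) (c ^ N) - ρ d ∈ Ideal.span (Set.range r) := by
  choose N ρ hρ h using exists_pseudo_remainder mo r μ hr c hc
  let M := ∑ d ∈ D, N (α d)
  refine ⟨M, fun d => c ^ (M - N (α d)) • ρ (α d), fun d hd =>
    ⟨fun b hb => hρ _ b (support_smul hb), ?_⟩⟩
  have hle : N (α d) ≤ M := Finset.single_le_sum (f := fun d => N (α d)) (by simp) hd
  convert Ideal.mul_mem_left _ (C (c ^ (M - N (α d)))) (h (α d)) using 1
  rw [mul_sub, C_mul_monomial, ← pow_add, Nat.sub_add_cancel hle, ← smul_eq_C_mul]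

lemma eval_sumElim_map_eval₂_rename_inr {k K σ τ : Type*} [CommRing k] [CommRing K] (f : k →+* K)
    (x : σ → K) (z : τ → K) (p : MvPolynomial σ (MvPolynomial τ k)) :
    eval (Sum.elim x z) (MvPolynomial.map f
        (eval₂ (rename (R := k) (Sum.inr : τ → σ ⊕ τ)).toRingHom
          (fun i => X (Sum.inl i)) p)) =
      eval₂ (eval₂Hom f z) x p := by
  rw [eval_map, ← coe_eval₂Hom, eval₂_comp_left]
  congr 1
  · ext i <;> simp
  · ext i; simp

/-- The polynomial obtained from `q = ∑ coeff d q * X ^ (d ∘ inl) * Z ^ (d ∘ inr)` by replacing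
`X ^ (d ∘ inl)` with the image of `ρ d` under `φ`, and `Z` with `y`. -/
noncomputable def remainderAt {K B : Type*} [Field K] [CommRing B] {n r : ℕ}
    (q : MvPolynomial (Fin n ⊕ Fin r) K) (ρ : (Fin n ⊕ Fin r →₀ ℕ) → MvPolynomial (Fin n) B)
    (φ : B →+* K) (y : Fin r → K) : MvPolynomial (Fin n) K :=
  ∑ d ∈ q.support, C (coeff d q * ∏ i, y i ^ d (Sum.inr i)) * MvPolynomial.map φ (ρ d)

lemma eval_remainderAt {K B ι : Type*} [Field K] [CommRing B] {n r : ℕ}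
    (q : MvPolynomial (Fin n ⊕ Fin r) K) (ρ : (Fin n ⊕ Fin r →₀ ℕ) → MvPolynomial (Fin n) B)
    (φ : B →+* K) (x : Fin n → K) (y : Fin r → K) (g : ι → MvPolynomial (Fin n) B)
    (hg : ∀ i, eval₂ φ x (g i) = 0) (c : B)
    (hρ : ∀ d ∈ q.support,
      monomial (Finsupp.equivFunOnFinite.symm fun i => d (Sum.inl i)) c - ρ d ∈
        Ideal.span (Set.range g)) :
    eval x (remainderAt q ρ φ y) = φ c * eval (Sum.elim x y) q := by
  have hker : Ideal.span (Set.range g) ≤ RingHom.ker (eval₂Hom φ x) := by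
    rw [Ideal.span_le]
    rintro _ ⟨i, rfl⟩
    exact hg i
  rw [remainderAt, map_sum, eval_eq', Finset.mul_sum]
  refine Finset.sum_congr rfl fun d hd => ?_
  have h1 := hker (hρ d hd)
  rw [RingHom.mem_ker, map_sub, sub_eq_zero, eval₂Hom_monomial] at h1
  rw [map_mul, eval_C, eval_map, ← coe_eval₂Hom, ← h1, Fintype.prod_sum_type,
    Finsupp.prod_fintype _ _ (by simp)]
  simp only [Finsupp.equivFunOnFinite_symm_apply_apply, Sum.elim_inl, Sum.elim_inr]
  ring

/-- Each coefficient of `remainderAt q ρ` is given by a homogeneous polynomial. -/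
lemma exists_isHomogeneous_eval₂_eq_coeff_remainderAt {K : Type*} [Field K] {k : Subfield K}
    {n r s : ℕ} (q : MvPolynomial (Fin n ⊕ Fin r) K) (hq : ∀ d, coeff d q ∈ k)
    (hhom : HomogeneousInZ q)
    (ρ : (Fin n ⊕ Fin r →₀ ℕ) → MvPolynomial (Fin n) (MvPolynomial (Fin s) k))
    (b : Fin n →₀ ℕ) :
    ∃ (P : MvPolynomial (Fin r) (MvPolynomial (Fin s) k)) (d : ℕ), P.IsHomogeneous d ∧
      ∀ (z : Fin s → K) (y : Fin r → K), eval₂ (eval₂Hom k.subtype z) y P =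
        coeff b (remainderAt q ρ (eval₂Hom k.subtype z) y) := by
  obtain ⟨N, hN⟩ := hhom
  refine ⟨∑ d ∈ q.support, monomial (Finsupp.equivFunOnFinite.symm fun i => d (Sum.inr i))
    (C ⟨coeff d q, hq d⟩ * coeff b (ρ d)), N, ?_, fun z y => ?_⟩
  · refine IsHomogeneous.sum _ _ _ fun d hd => isHomogeneous_monomial _ ?_
    rw [← hN (mem_support_iff.1 hd), Finsupp.weight_apply, Finsupp.sum_fintype _ _ (by simp),
      Finsupp.degree_eq_sum]
    simp
  · rw [remainderAt, eval₂_sum, coeff_sum]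
    refine Finset.sum_congr rfl fun d _ => ?_
    rw [eval₂_monomial, coeff_C_mul, coeff_map, map_mul, Finsupp.prod_fintype _ _ (by simp)]
    simp only [Finsupp.equivFunOnFinite_symm_apply_apply, coe_eval₂Hom, eval₂_C,
      Subfield.coe_subtype]
    ring

/-- Let `E ⊊ K` be a proper pair of algebraically closed fields, `k` a
λ-closed subfield of `K` and `a ∈ K^n`. Then there are `s ≥ 1`, polynomials
`γ₁, …, γ_t` and `σ` in `k[Z₁, …, Z_s]` and polynomials `r₁, …, r_l` in
`k[X₁, …, X_n, Z₁, …, Z_s]` such that the set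
`Θ = {x | ∃ ζ ∈ E^s, γ_u(ζ) = 0 ∀ u, σ(ζ) ≠ 0, r_i(x, ζ) = 0 ∀ i}` contains `a` and is
contained in every tame subset of `K^n` over `k` containing `a`. -/
theorem exists_definable_core {K : Type*} [Field K] [IsAlgClosed K]
    (E : Subfield K) (hE : IsAlgClosed E) (hEproper : E ≠ ⊤)
    (k : Subfield K) (hk : LambdaClosed E k)
    (n : ℕ) (a : Fin n → K) :
    ∃ (s t l : ℕ), 0 < s ∧
      ∃ (γ : Fin t → MvPolynomial (Fin s) K) (σp : MvPolynomial (Fin s) K)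
        (r : Fin l → MvPolynomial (Fin n ⊕ Fin s) K),
        (∀ u d, coeff d (γ u) ∈ k) ∧ (∀ d, coeff d σp ∈ k) ∧
        (∀ i d, coeff d (r i) ∈ k) ∧
        a ∈ {x : Fin n → K | ∃ ζ : Fin s → K, (∀ i, ζ i ∈ E) ∧
              (∀ u, MvPolynomial.eval ζ (γ u) = 0) ∧
              MvPolynomial.eval ζ σp ≠ 0 ∧
              ∀ i, MvPolynomial.eval (Sum.elim x ζ) (r i) = 0} ∧
        ∀ S : Set (Fin n → K), IsTameSetOver E k S → a ∈ S →
          {x : Fin n → K | ∃ ζ : Fin s → K, (∀ i, ζ i ∈ E) ∧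
              (∀ u, MvPolynomial.eval ζ (γ u) = 0) ∧
              MvPolynomial.eval ζ σp ≠ 0 ∧
              ∀ i, MvPolynomial.eval (Sum.elim x ζ) (r i) = 0} ⊆ S := by
  classical
  let mo : MonomialOrder (Fin n) := MonomialOrder.lex
  let R := Algebra.adjoin k (E : Set K)
  let J : Set (MvPolynomial (Fin n) K) := {f | (∀ m, coeff m f ∈ R) ∧ eval a f = 0}
  obtain ⟨G, hGJ, hG⟩ := exists_finset_degree_le mo J
  obtain ⟨s, e, p, hs, hp⟩ := exists_eval₂_eq_of_mem_adjoin E k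
    (G.biUnion fun g => g.support.image fun m => coeff m g) (by
      simp only [Finset.mem_biUnion, Finset.mem_image]
      rintro x ⟨g, hg, m, -, rfl⟩
      exact (hGJ g hg).1.1 m)
  let ev : (Fin s → E) → MvPolynomial (Fin s) k →+* K := fun z =>
    eval₂Hom k.subtype fun i => (z i : K)
  have hp' : ∀ g ∈ G, ∀ m ∈ g.support, ev e (p (coeff m g)) = coeff m g := fun g hg m hm =>
    hp _ (Finset.mem_biUnion.2 ⟨g, hg, Finset.mem_image_of_mem _ hm⟩)
  let rB : G → MvPolynomial (Fin n) (MvPolynomial (Fin s) k) := fun g =>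
    ∑ m ∈ g.1.support, monomial m (p (coeff m g.1))
  let μ : G → Fin n →₀ ℕ := fun g => mo.degree g.1
  have hcoeff : ∀ g : G, ∀ m, coeff m (rB g) = if m ∈ g.1.support then p (coeff m g.1) else 0 := by
    intro g m
    simp [rB, coeff_sum, coeff_monomial]
  have hrB : ∀ g : G, MvPolynomial.map (ev e) (rB g) = g.1 := by
    intro g
    ext m
    rw [coeff_map, hcoeff]
    split_ifs with hm
    · exact hp' g.1 g.2 m hm
    · rw [map_zero, notMem_support_iff.1 hm]
  have hdeg : ∀ g, ∀ m ∈ (rB g).support, mo.toSyn m ≤ mo.toSyn (μ g) := by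
    intro g m hm
    rw [mem_support_iff, hcoeff] at hm
    exact mo.le_degree (by_contra fun h => hm (if_neg h))
  let c : MvPolynomial (Fin s) k := ∏ g, coeff (μ g) (rB g)
  have hc : ∀ g, coeff (μ g) (rB g) ∣ c := fun g => Finset.dvd_prod_of_mem _ (Finset.mem_univ g)
  have hce : ev e c ≠ 0 := by
    rw [map_prod]
    refine Finset.prod_ne_zero_iff.2 fun g _ => ?_
    rw [← coeff_map, hrB]
    exact mem_support_iff.1 (mo.degree_mem_support (hGJ g.1 g.2).2)
  obtain ⟨Γ, hΓ⟩ := IsNoetherian.noetherian (RingHom.ker (ev e))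
  refine ⟨s, Γ.card, G.card, hs, fun u => MvPolynomial.map k.subtype (Γ.equivFin.symm u).1,
    MvPolynomial.map k.subtype c,
    fun i => MvPolynomial.map k.subtype (eval₂
      (rename (R := k) (Sum.inr : Fin s → Fin n ⊕ Fin s)).toRingHom
      (fun i => X (Sum.inl i)) (rB (G.equivFin.symm i))),
    fun u d => ?_, fun d => ?_, fun i d => ?_, ?_, ?_⟩
  · rw [coeff_map]; exact Subtype.coe_prop _
  · rw [coeff_map]; exact Subtype.coe_prop _
  · rw [coeff_map]; exact Subtype.coe_prop _
  · refine ⟨fun i => e i, fun i => (e i).2, fun u => ?_, ?_, fun i => ?_⟩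
    · rw [eval_map]
      have : (Γ.equivFin.symm u).1 ∈ RingHom.ker (ev e) := by
        rw [← hΓ]
        exact Ideal.subset_span (Γ.equivFin.symm u).2
      exact this
    · rw [eval_map]
      exact hce
    · rw [eval_sumElim_map_eval₂_rename_inr]
      change eval₂ (ev e) a _ = 0
      rw [← eval_map, hrB]
      exact (hGJ _ (Finset.coe_mem _)).1.2
  · rintro S ⟨r, m, -, -, q, hqk, hqhom, rfl⟩ ⟨ξ, hξE, hξ0, hξ⟩ x ⟨ζ', hζE, hζγ, hζσ, hζr⟩
    obtain ⟨ζ, rfl⟩ : ∃ ζ : Fin s → E, ζ' = fun i => (ζ i : K) := ⟨fun i => ⟨ζ' i, hζE i⟩, rfl⟩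
    obtain ⟨ξ, rfl⟩ : ∃ y : Fin r → E, ξ = fun i => (y i : K) := ⟨fun i => ⟨ξ i, hξE i⟩, rfl⟩
    have hspec : RingHom.ker (ev e) ≤ RingHom.ker (ev ζ) := by
      rw [← hΓ]
      refine Ideal.span_le.2 fun g hg => ?_
      have := hζγ (Γ.equivFin ⟨g, hg⟩)
      simp only [Equiv.symm_apply_apply, eval_map] at this
      exact this
    obtain ⟨ξ', hξ'0, hξ'⟩ := hk.exists_specialization e ζ (fun p hp => hspec hp) ξ (by
      rintro rfl
      exact hξ0 rfl)
    refine ⟨fun i => ξ' i, fun i => (ξ' i).2, fun h => hξ'0 ?_, fun j => ?_⟩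
    · ext i
      exact congrFun h i
    obtain ⟨N, ρ, hρ⟩ := exists_pseudo_remainder_finset mo rB μ hdeg c hc (q j).support
      fun d => Finsupp.equivFunOnFinite.symm fun i => d (Sum.inl i)
    have hzero : remainderAt (q j) ρ (ev e) (fun i => (ξ i : K)) = 0 := by
      by_contra hne
      have hJ : remainderAt (q j) ρ (ev e) (fun i => (ξ i : K)) ∈ J := by
        refine ⟨fun b => ?_, ?_⟩
        · rw [remainderAt, coeff_sum]
          refine Subalgebra.sum_mem _ fun d _ => ?_
          rw [coeff_C_mul, coeff_map]
          refine mul_mem (mul_mem (R.algebraMap_mem ⟨_, hqk j d⟩) (prod_mem fun i _ =>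
            pow_mem (Algebra.subset_adjoin (ξ i).2) _)) ?_
          exact eval₂_mem (fun d _ => R.algebraMap_mem _) fun i => Algebra.subset_adjoin (e i).2
        · rw [eval_remainderAt (q j) ρ (ev e) a _ rB (fun g => ?_) (c ^ N) fun d hd => (hρ d hd).2,
            hξ j, mul_zero]
          rw [← eval_map, hrB]
          exact (hGJ g.1 g.2).1.2
      obtain ⟨g, hg, hle⟩ := hG _ hJ hne
      have hmem := mo.degree_mem_support hne
      obtain ⟨d, hd, hdb⟩ := Finset.mem_biUnion.1 (support_sum hmem)
      rw [← smul_eq_C_mul] at hdb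
      exact (hρ d hd).1 _ (support_map_subset _ _ (support_smul hdb)) ⟨g, hg⟩ hle
    have hzero' : remainderAt (q j) ρ (ev ζ) (fun i => (ξ' i : K)) = 0 := by
      ext b
      obtain ⟨P, d, hP, hPb⟩ :=
        exists_isHomogeneous_eval₂_eq_coeff_remainderAt (q j) (hqk j) (hqhom j) ρ b
      rw [← hPb, hξ' P d hP, coeff_zero]
      rw [hPb]
      exact congrArg (coeff b) hzero
    have h1 := eval_remainderAt (q j) ρ (ev ζ) x (fun i => (ξ' i : K)) rB (fun g => by
      have := hζr (G.equivFin g)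
      rwa [eval_sumElim_map_eval₂_rename_inr, Equiv.symm_apply_apply] at this) (c ^ N)
      fun d hd => (hρ d hd).2
    rw [hzero', map_zero, map_pow] at h1
    refine (mul_eq_zero.1 h1.symm).resolve_left (pow_ne_zero _ ?_)
    rw [eval_map] at hζσ
    exact hζσ
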